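/- arXiv:math/0008038 — 4 statements merged into one kernel-verified Lean document; each statement's English description precedes it below -/
import Mathlib

section
/- Let g(x,y) = (1/√2)·[[e^{ix}, e^{iy}], [−e^{−iy}, e^{−ix}]], a = g⁻¹·∂g/∂x, b = g⁻¹·∂g/∂y. Then the energy E := (1/2)·∫₀^{2π}∫₀^{2π} ( −4·tr(a(x,y)²) − 4·tr(b(x,y)²) ) dx dy equals 16π² (the integrand is real-valued). -/
open Matrix Real

/-- The energy of the Clifford torus map,
`E = (1/2)·∫₀^{2π}∫₀^{2π} (−4 tr(a²) − 4 tr(b²)) dx dy` with `a = g⁻¹ ∂ₓ g`,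
`b = g⁻¹ ∂ᵧ g`, equals `16π²` (and the integrand is real-valued). -/
theorem cliffordTorus_energy
    (g : ℝ → ℝ → Matrix (Fin 2) (Fin 2) ℂ)
    (hg : ∀ x y : ℝ, g x y = ((Real.sqrt 2 : ℂ))⁻¹ •
      !![Complex.exp (Complex.I * x), Complex.exp (Complex.I * y);
         -Complex.exp (-(Complex.I * y)), Complex.exp (-(Complex.I * x))])
    (a b : ℝ → ℝ → Matrix (Fin 2) (Fin 2) ℂ)
    (ha : ∀ x y : ℝ, a x y = (g x y)⁻¹ *
      Matrix.of (fun i j => deriv (fun t : ℝ => g t y i j) x))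
    (hb : ∀ x y : ℝ, b x y = (g x y)⁻¹ *
      Matrix.of (fun i j => deriv (fun t : ℝ => g x t i j) y)) :
    (∀ x y : ℝ,
      (-4 * (a x y * a x y).trace - 4 * (b x y * b x y).trace).im = 0) ∧
    (1 / 2 : ℂ) * ∫ x in (0:ℝ)..(2 * π), ∫ y in (0:ℝ)..(2 * π),
        (-4 * (a x y * a x y).trace - 4 * (b x y * b x y).trace)
      = 16 * (π : ℂ) ^ 2 := by
  have hs : ((Real.sqrt 2 : ℂ))⁻¹ * ((Real.sqrt 2 : ℂ))⁻¹ = 1 / 2 := by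
    rw [← mul_inv, ← Complex.ofReal_mul, Real.mul_self_sqrt (by norm_num)]
    norm_num
  have he : ∀ x : ℝ, Complex.exp (Complex.I * x) * Complex.exp (-(Complex.I * x)) = 1 := by
    intro x
    rw [← Complex.exp_add]; simp
  have hinv : ∀ x y : ℝ, (g x y)⁻¹ = ((Real.sqrt 2 : ℂ))⁻¹ •
      !![Complex.exp (-(Complex.I * x)), -Complex.exp (Complex.I * y);
         Complex.exp (-(Complex.I * y)), Complex.exp (Complex.I * x)] := by
    intro x y
    apply Matrix.inv_eq_left_inv
    rw [hg]
    have h1 := he x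
    have h2 := he y
    ext i j
    fin_cases i <;> fin_cases j <;> simp [Matrix.mul_apply, Fin.sum_univ_two] <;> grind
  have d1 : ∀ (c : ℂ) (x : ℝ), HasDerivAt (fun t : ℝ => c * Complex.exp (Complex.I * t))
      (c * (Complex.exp (Complex.I * x) * Complex.I)) x := by
    intro c x
    have := ((Complex.ofRealCLM.hasDerivAt (x := x)).const_mul Complex.I).cexp.const_mul c
    simpa using this
  have d2 : ∀ (c : ℂ) (x : ℝ), HasDerivAt (fun t : ℝ => c * Complex.exp (-(Complex.I * t)))
      (c * (Complex.exp (-(Complex.I * x)) * -Complex.I)) x := by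
    intro c x
    have := ((Complex.ofRealCLM.hasDerivAt (x := x)).const_mul Complex.I).neg.cexp.const_mul c
    simpa using this
  have hgx : ∀ x y : ℝ, Matrix.of (fun i j => deriv (fun t : ℝ => g t y i j) x) =
      ((Real.sqrt 2 : ℂ))⁻¹ • !![Complex.exp (Complex.I * x) * Complex.I, 0;
        0, Complex.exp (-(Complex.I * x)) * -Complex.I] := by
    intro x y
    ext i j
    have e1 := (d1 ((Real.sqrt 2 : ℂ))⁻¹ x).deriv
    have e2 := (d2 ((Real.sqrt 2 : ℂ))⁻¹ x).deriv
    fin_cases i <;> fin_cases j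
    · simpa [hg] using e1
    · simp [hg]
    · simp [hg]
    · simpa [hg] using e2
  have hgy : ∀ x y : ℝ, Matrix.of (fun i j => deriv (fun t : ℝ => g x t i j) y) =
      ((Real.sqrt 2 : ℂ))⁻¹ • !![0, Complex.exp (Complex.I * y) * Complex.I;
        Complex.exp (-(Complex.I * y)) * Complex.I, 0] := by
    intro x y
    ext i j
    have e1 := (d1 ((Real.sqrt 2 : ℂ))⁻¹ y).deriv
    have e2 := (d2 (-((Real.sqrt 2 : ℂ))⁻¹) y).deriv
    fin_cases i <;> fin_cases j
    · simp [hg]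
    · simpa [hg] using e1
    · simpa [hg] using e2
    · simp [hg]
  have key : ∀ x y : ℝ,
      (-4 * (a x y * a x y).trace - 4 * (b x y * b x y).trace) = 8 := by
    intro x y
    have h1 := he x
    have h2 := he y
    have hI := Complex.I_mul_I
    have hta : (a x y * a x y).trace = -1 := by
      rw [ha, hinv, hgx]
      simp only [Matrix.trace_fin_two, Matrix.mul_apply, Fin.sum_univ_two, Matrix.smul_apply,
        Matrix.of_apply, Matrix.cons_val', Matrix.cons_val_zero, Matrix.cons_val_one,
        Matrix.cons_val_fin_one, smul_eq_mul]
      generalize ((Real.sqrt 2 : ℂ))⁻¹ = s at *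
      grind
    have htb : (b x y * b x y).trace = -1 := by
      rw [hb, hinv, hgy]
      simp only [Matrix.trace_fin_two, Matrix.mul_apply, Fin.sum_univ_two, Matrix.smul_apply,
        Matrix.of_apply, Matrix.cons_val', Matrix.cons_val_zero, Matrix.cons_val_one,
        Matrix.cons_val_fin_one, smul_eq_mul]
      generalize ((Real.sqrt 2 : ℂ))⁻¹ = s at *
      grind
    rw [hta, htb]; norm_num
  refine ⟨fun x y => by rw [key]; simp, ?_⟩
  simp only [key, intervalIntegral.integral_const]
  simp
  ring
end

section
/- Define L₁, L₂ : ℝ → ℂ by L₁(θ) = (π/2)(1+i)(e^{iθ/2} + i·e^{−iθ/2}) + iπ and L₂(θ) = (π/2)(1−i)(e^{iθ/2} − i·e^{−iθ/2}) − iπ. Then ∫₀^π L₁(θ)·L₂′(θ) dθ = −π³/2 − 3π², where L₂′ denotes the derivative of L₂. -/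
open Real

/-- For the Clifford torus logarithms
`L₁(θ) = (π/2)(1+i)(e^{iθ/2} + i e^{−iθ/2}) + iπ` and
`L₂(θ) = (π/2)(1−i)(e^{iθ/2} − i e^{−iθ/2}) − iπ`, one has
`∫₀^π L₁ L₂′ dθ = −π³/2 − 3π²`. -/
theorem cliffordTorus_hyperelliptic_integral
    (L₁ L₂ : ℝ → ℂ)
    (hL₁ : ∀ θ : ℝ, L₁ θ = ((π : ℂ) / 2) * (1 + Complex.I) *
      (Complex.exp (Complex.I * θ / 2) + Complex.I * Complex.exp (-(Complex.I * θ / 2)))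
      + Complex.I * (π : ℂ))
    (hL₂ : ∀ θ : ℝ, L₂ θ = ((π : ℂ) / 2) * (1 - Complex.I) *
      (Complex.exp (Complex.I * θ / 2) - Complex.I * Complex.exp (-(Complex.I * θ / 2)))
      - Complex.I * (π : ℂ)) :
    ∫ θ in (0:ℝ)..π, L₁ θ * deriv L₂ θ = -((π : ℂ) ^ 3 / 2) - 3 * (π : ℂ) ^ 2 := by
  have hlin : ∀ θ : ℝ, HasDerivAt (fun θ : ℝ => Complex.I * (θ : ℂ) / 2) (Complex.I / 2) θ := by
    intro θ
    have h := ((Complex.ofRealCLM.hasDerivAt (x := θ)).const_mul Complex.I).div_const 2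
    simpa using h
  have ha : ∀ θ : ℝ, HasDerivAt (fun θ : ℝ => Complex.exp (Complex.I * (θ : ℂ) / 2))
      (Complex.exp (Complex.I * (θ : ℂ) / 2) * (Complex.I / 2)) θ := fun θ => (hlin θ).cexp
  have hb : ∀ θ : ℝ, HasDerivAt (fun θ : ℝ => Complex.exp (-(Complex.I * (θ : ℂ) / 2)))
      (Complex.exp (-(Complex.I * (θ : ℂ) / 2)) * (-(Complex.I / 2))) θ :=
    fun θ => (hlin θ).neg.cexp
  have hd : ∀ θ : ℝ, deriv L₂ θ = ((π : ℂ) / 2) * (1 - Complex.I) *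
      (Complex.exp (Complex.I * (θ : ℂ) / 2) * (Complex.I / 2) -
        Complex.I * (Complex.exp (-(Complex.I * (θ : ℂ) / 2)) * (-(Complex.I / 2)))) := by
    intro θ
    rw [funext hL₂]
    exact ((((ha θ).sub ((hb θ).const_mul Complex.I)).const_mul _).sub_const _).deriv
  have hI : Complex.I ^ 2 = -1 := Complex.I_sq
  have hF : ∀ θ ∈ Set.uIcc (0 : ℝ) π, HasDerivAt (fun θ : ℝ =>
      -((π : ℂ) ^ 2 / 2) * ((θ : ℂ) - (Complex.exp (Complex.I * (θ : ℂ) / 2) ^ 2 +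
        Complex.exp (-(Complex.I * (θ : ℂ) / 2)) ^ 2) / 2)
      - (π : ℂ) ^ 2 / 4 * (1 - Complex.I) * (-2 * Complex.I * Complex.exp (Complex.I * (θ : ℂ) / 2)
        - 2 * Complex.exp (-(Complex.I * (θ : ℂ) / 2)))) (L₁ θ * deriv L₂ θ) θ := by
    intro θ _
    have hx : HasDerivAt (fun θ : ℝ => (θ : ℂ)) 1 θ := by
      exact (hasDerivAt_id θ).ofReal_comp
    have h := ((hx.sub ((((ha θ).pow 2).add ((hb θ).pow 2)).div_const 2)).const_mul
      (-((π : ℂ) ^ 2 / 2))).sub ((((ha θ).const_mul (-2 * Complex.I)).sub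
        ((hb θ).const_mul 2)).const_mul ((π : ℂ) ^ 2 / 4 * (1 - Complex.I)))
    refine h.congr_deriv ?_
    rw [hd, hL₁]
    have hab : Complex.exp (Complex.I * (θ : ℂ) / 2) * Complex.exp (-(Complex.I * (θ : ℂ) / 2)) = 1 := by
      rw [← Complex.exp_add]; simp
    generalize Complex.exp (Complex.I * (θ : ℂ) / 2) = a at *
    generalize Complex.exp (-(Complex.I * (θ : ℂ) / 2)) = b at *
    generalize Complex.I = j at *
    clear h hx hd ha hb hL₁ hL₂ hlin
    push_cast
    grind
  have hc : Continuous (fun θ : ℝ => L₁ θ * deriv L₂ θ) := by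
    simp only [hd, hL₁]
    fun_prop
  rw [intervalIntegral.integral_eq_sub_of_hasDerivAt hF (hc.intervalIntegrable _ _)]
  have h1 : Complex.exp (Complex.I * (π : ℂ) / 2) = Complex.I := by
    rw [show Complex.I * (π : ℂ) / 2 = (π : ℂ) / 2 * Complex.I by ring]
    exact Complex.exp_pi_div_two_mul_I
  have h2 : Complex.exp (-(Complex.I * (π : ℂ) / 2)) = -Complex.I := by
    rw [Complex.exp_neg, h1, Complex.inv_I]
  simp only [h1, h2, Complex.ofReal_zero, mul_zero, zero_div, neg_zero, Complex.exp_zero]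
  generalize Complex.I = j at *
  clear hc hF hd ha hb hL₁ hL₂ hlin h1 h2
  grind
end

section
/- Let n ≥ 1 and let a, b ∈ Mₙ(ℂ) be fixed matrices. Put φ = (a − i·b)/2 and ψ = (a + i·b)/2, and for θ ∈ ℝ define A_x(θ) = ((1−e^{iθ})/2)·φ + ((1−e^{−iθ})/2)·ψ and A_y(θ) = (i(1−e^{iθ})/2)·φ − (i(1−e^{−iθ})/2)·ψ. Then for every θ ∈ ℝ: tr(A_x(θ)·A_y′(θ)) − tr(A_y(θ)·A_x′(θ)) = (cos θ − 1)·tr(φ·ψ), where ′ denotes d/dθ. -/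
open Matrix Real

/-- For fixed `n × n` complex matrices `a, b`, with `φ = (a−ib)/2`,
`ψ = (a+ib)/2` and the loop of connection components
`A_x(θ) = ((1−e^{iθ})/2)φ + ((1−e^{−iθ})/2)ψ`,
`A_y(θ) = (i(1−e^{iθ})/2)φ − (i(1−e^{−iθ})/2)ψ`, one has
`tr(A_x A_y′) − tr(A_y A_x′) = (cos θ − 1)·tr(φψ)` for every `θ`. -/
theorem connection_loop_trace_identity
    (n : ℕ) (hn : 1 ≤ n) (a b : Matrix (Fin n) (Fin n) ℂ)
    (φ ψ : Matrix (Fin n) (Fin n) ℂ)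
    (hφ : φ = ((2 : ℂ))⁻¹ • (a - Complex.I • b))
    (hψ : ψ = ((2 : ℂ))⁻¹ • (a + Complex.I • b))
    (Ax Ay : ℝ → Matrix (Fin n) (Fin n) ℂ)
    (hAx : ∀ θ : ℝ, Ax θ = ((1 - Complex.exp (Complex.I * θ)) / 2) • φ
      + ((1 - Complex.exp (-(Complex.I * θ))) / 2) • ψ)
    (hAy : ∀ θ : ℝ, Ay θ = ((Complex.I * (1 - Complex.exp (Complex.I * θ))) / 2) • φ
      - ((Complex.I * (1 - Complex.exp (-(Complex.I * θ)))) / 2) • ψ) :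
    ∀ θ : ℝ,
      (Ax θ * Matrix.of (fun i j => deriv (fun t : ℝ => Ay t i j) θ)).trace
        - (Ay θ * Matrix.of (fun i j => deriv (fun t : ℝ => Ax t i j) θ)).trace
      = ((Real.cos θ : ℂ) - 1) * (φ * ψ).trace := by
  intro θ
  have hI : Complex.I * Complex.I = -1 := Complex.I_mul_I
  have hE : HasDerivAt (fun t : ℝ => Complex.exp (Complex.I * t))
      (Complex.exp (Complex.I * θ) * (Complex.I * 1)) θ :=
    ((Complex.ofRealCLM.hasDerivAt (x := θ)).const_mul Complex.I).cexp
  have hF : HasDerivAt (fun t : ℝ => Complex.exp (-(Complex.I * t)))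
      (Complex.exp (-(Complex.I * θ)) * (-(Complex.I * 1))) θ :=
    ((Complex.ofRealCLM.hasDerivAt (x := θ)).const_mul Complex.I).neg.cexp
  have hcos : (Real.cos θ : ℂ) =
      (Complex.exp (Complex.I * θ) + Complex.exp (-(Complex.I * θ))) / 2 := by
    rw [Complex.ofReal_cos, Complex.cos]
    ring_nf
  have hEF : Complex.exp (Complex.I * θ) * Complex.exp (-(Complex.I * θ)) = 1 := by
    rw [← Complex.exp_add]; simp
  have hAx' : Matrix.of (fun i j => deriv (fun t : ℝ => Ax t i j) θ)
      = (-(Complex.I * Complex.exp (Complex.I * θ)) / 2) • φ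
        + ((Complex.I * Complex.exp (-(Complex.I * θ))) / 2) • ψ := by
    ext i j
    have h := (((hE.const_sub 1).div_const 2).mul_const (φ i j)).add
      (((hF.const_sub 1).div_const 2).mul_const (ψ i j))
    have e : (fun t : ℝ => Ax t i j) = fun t : ℝ =>
        ((1 - Complex.exp (Complex.I * t)) / 2) * φ i j
        + ((1 - Complex.exp (-(Complex.I * t))) / 2) * ψ i j := by
      funext t; simp [hAx]
    rw [Matrix.of_apply, e]
    refine h.deriv.trans ?_
    simp only [Matrix.add_apply, Matrix.smul_apply, smul_eq_mul]
    ring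
  have hAy' : Matrix.of (fun i j => deriv (fun t : ℝ => Ay t i j) θ)
      = (Complex.exp (Complex.I * θ) / 2) • φ
        + (Complex.exp (-(Complex.I * θ)) / 2) • ψ := by
    ext i j
    have h := ((((hE.const_sub 1).const_mul Complex.I).div_const 2).mul_const (φ i j)).sub
      ((((hF.const_sub 1).const_mul Complex.I).div_const 2).mul_const (ψ i j))
    have e : (fun t : ℝ => Ay t i j) = fun t : ℝ =>
        (Complex.I * (1 - Complex.exp (Complex.I * t)) / 2) * φ i j
        - (Complex.I * (1 - Complex.exp (-(Complex.I * t))) / 2) * ψ i j := by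
      funext t; simp [hAy]
    rw [Matrix.of_apply, e]
    refine h.deriv.trans ?_
    simp only [Matrix.add_apply, Matrix.smul_apply, smul_eq_mul]
    linear_combination (-(Complex.exp (Complex.I * θ) * φ i j
      + Complex.exp (-(Complex.I * θ)) * ψ i j) / 2) * hI
  rw [hAx', hAy', hAx, hAy, hcos]
  generalize Complex.exp (Complex.I * θ) = E at *
  generalize Complex.exp (-(Complex.I * θ)) = F at *
  simp only [Matrix.add_mul, Matrix.sub_mul, Matrix.mul_add, Matrix.smul_mul, Matrix.mul_smul,
    Matrix.trace_add, Matrix.trace_sub, Matrix.trace_smul, smul_eq_mul]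
  rw [Matrix.trace_mul_comm ψ φ]
  generalize (φ * ψ).trace = T
  generalize (φ * φ).trace = P
  generalize (ψ * ψ).trace = Q
  linear_combination ((1 - E) * E / 4 * P + (1 - F) * F / 4 * Q
    - ((1 - E) * F + (1 - F) * E) / 4 * T) * hI - T * hEF
end

section
/- Let g : ℝ² → Mₙ(ℂ) be twice continuously differentiable with g(x,y) invertible for all (x,y), and set a = g⁻¹·∂_x g and b = g⁻¹·∂_y g. Assume the harmonic map equation ∂_x a + ∂_y b = 0. Put φ = (a − i·b)/2 and ψ = (a + i·b)/2. Then for every ζ ∈ ℂ with ζ ≠ 0, the matrices A_x = ((1−ζ)/2)·φ + ((1−ζ⁻¹)/2)·ψ and A_y = (i(1−ζ)/2)·φ − (i(1−ζ⁻¹)/2)·ψ (functions of (x,y)) satisfy the zero-curvature equation ∂_x A_y − ∂_y A_x + A_x·A_y − A_y·A_x = 0 identically on ℝ². -/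
open Matrix Real


lemma hm_fderiv_x {f : ℝ × ℝ → ℂ} (hf : Differentiable ℝ f) (x y : ℝ) :
    deriv (fun t : ℝ => f (t, y)) x = fderiv ℝ f (x, y) (1, 0) := by
  have h1 : HasDerivAt (fun t : ℝ => (t, y)) ((1 : ℝ), (0 : ℝ)) x :=
    (hasDerivAt_id x).prodMk (hasDerivAt_const x y)
  exact ((hf (x, y)).hasFDerivAt.comp_hasDerivAt x h1).deriv

lemma hm_fderiv_y {f : ℝ × ℝ → ℂ} (hf : Differentiable ℝ f) (x y : ℝ) :
    deriv (fun t : ℝ => f (x, t)) y = fderiv ℝ f (x, y) (0, 1) := by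
  have h1 : HasDerivAt (fun t : ℝ => (x, t)) ((0 : ℝ), (1 : ℝ)) y :=
    (hasDerivAt_const y x).prodMk (hasDerivAt_id y)
  exact ((hf (x, y)).hasFDerivAt.comp_hasDerivAt y h1).deriv

lemma hm_diff_fderiv {f : ℝ × ℝ → ℂ} (hf : ContDiff ℝ 2 f) :
    Differentiable ℝ (fderiv ℝ f) :=
  (hf.fderiv_right (m := 1) (by norm_num)).differentiable (by norm_num)

lemma hm_diff_app {f : ℝ × ℝ → ℂ} (hf : ContDiff ℝ 2 f) (v : ℝ × ℝ) :
    Differentiable ℝ (fun p => fderiv ℝ f p v) := fun p =>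
  (hm_diff_fderiv hf p).clm_apply (differentiableAt_const v)

lemma hm_fderiv_app {f : ℝ × ℝ → ℂ} (hf : ContDiff ℝ 2 f) (v w p : ℝ × ℝ) :
    fderiv ℝ (fun p => fderiv ℝ f p v) p w = fderiv ℝ (fderiv ℝ f) p w v := by
  rw [fderiv_clm_apply (hm_diff_fderiv hf p) (differentiableAt_const v)]
  simp

lemma hm_symm {f : ℝ × ℝ → ℂ} (hf : ContDiff ℝ 2 f) (x y : ℝ) :
    deriv (fun t : ℝ => deriv (fun s : ℝ => f (s, t)) x) y
      = deriv (fun s : ℝ => deriv (fun t : ℝ => f (s, t)) y) x := by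
  have hd : Differentiable ℝ f := hf.differentiable (by norm_num)
  simp only [hm_fderiv_x hd, hm_fderiv_y hd]
  rw [hm_fderiv_y (f := fun p => fderiv ℝ f p (1, 0)) (hm_diff_app hf _),
    hm_fderiv_x (f := fun p => fderiv ℝ f p (0, 1)) (hm_diff_app hf _),
    hm_fderiv_app hf, hm_fderiv_app hf]
  exact (hf.contDiffAt.isSymmSndFDerivAt (by simp)) _ _

lemma hm_det {n : ℕ} {M : ℝ × ℝ → Matrix (Fin n) (Fin n) ℂ}
    (h : ∀ i j, Differentiable ℝ (fun p => M p i j)) :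
    Differentiable ℝ (fun p => (M p).det) := by
  simp only [Matrix.det_apply']
  fun_prop

lemma hm_inv {n : ℕ} {M : ℝ × ℝ → Matrix (Fin n) (Fin n) ℂ}
    (h : ∀ i j, Differentiable ℝ (fun p => M p i j)) (hu : ∀ p, IsUnit (M p)) (i j : Fin n) :
    Differentiable ℝ (fun p => (M p)⁻¹ i j) := by
  have hdet : ∀ p, (M p).det ≠ 0 := fun p =>
    ((Matrix.isUnit_iff_isUnit_det _).1 (hu p)).ne_zero
  simp only [Matrix.inv_def, Ring.inverse_eq_inv', Matrix.smul_apply, smul_eq_mul,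
    Matrix.adjugate_apply]
  refine ((hm_det h).inv hdet).mul (hm_det ?_)
  intro k l
  simp only [Matrix.updateRow_apply]
  split_ifs
  · exact differentiable_const _
  · exact h k l

lemma hm_mul {n : ℕ} {M N : ℝ × ℝ → Matrix (Fin n) (Fin n) ℂ}
    (hM : ∀ i j, Differentiable ℝ (fun p => M p i j))
    (hN : ∀ i j, Differentiable ℝ (fun p => N p i j)) (i j : Fin n) :
    Differentiable ℝ (fun p => (M p * N p) i j) := by
  simp only [Matrix.mul_apply]
  fun_prop

lemma hm_leibniz {n : ℕ} {M N : ℝ → Matrix (Fin n) (Fin n) ℂ}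
    (hM : ∀ i j, Differentiable ℝ (fun p => M p i j))
    (hN : ∀ i j, Differentiable ℝ (fun p => N p i j)) (x : ℝ) :
    (Matrix.of fun i j => deriv (fun t => (M t * N t) i j) x)
      = (Matrix.of fun i j => deriv (fun t => M t i j) x) * N x
        + M x * (Matrix.of fun i j => deriv (fun t => N t i j) x) := by
  ext i j
  simp only [Matrix.of_apply, Matrix.add_apply, Matrix.mul_apply, ← Finset.sum_add_distrib]
  refine HasDerivAt.deriv (HasDerivAt.fun_sum fun k _ => ?_)
  exact (hM i k x).hasDerivAt.mul (hN k j x).hasDerivAt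

lemma hm_lin {n : ℕ} {M N : ℝ → Matrix (Fin n) (Fin n) ℂ}
    (hM : ∀ i j, Differentiable ℝ (fun p => M p i j))
    (hN : ∀ i j, Differentiable ℝ (fun p => N p i j)) (c d : ℂ) (x : ℝ) :
    (Matrix.of fun i j => deriv (fun t => (c • M t + d • N t) i j) x)
      = c • (Matrix.of fun i j => deriv (fun t => M t i j) x)
        + d • (Matrix.of fun i j => deriv (fun t => N t i j) x) := by
  ext i j
  simp only [Matrix.of_apply, Matrix.add_apply, Matrix.smul_apply, smul_eq_mul]
  exact (((hM i j x).hasDerivAt.const_mul c).add ((hN i j x).hasDerivAt.const_mul d)).deriv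

lemma hm_alg {n : ℕ} (a b ax ay bx bY : Matrix (Fin n) (Fin n) ℂ) (α β : ℂ)
    (h : α * α + β * β = α) (h1 : ax + bY = 0) (h2 : ay - bx = a * b - b * a) :
    ((-β) • ax + α • bx) - (α • ay + β • bY)
      + (α • a + β • b) * ((-β) • a + α • b) - ((-β) • a + α • b) * (α • a + β • b) = 0 := by
  have e1 : bY = -ax := by rw [eq_neg_iff_add_eq_zero, add_comm]; exact h1
  have e2 : ay = bx + (a * b - b * a) := by rw [← h2]; abel
  have key : ((-β) • ax + α • bx) - (α • ay + β • bY)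
      + (α • a + β • b) * ((-β) • a + α • b) - ((-β) • a + α • b) * (α • a + β • b)
      = (α * α + β * β - α) • (a * b - b * a) := by
    rw [e1, e2]
    simp only [mul_add, add_mul, Matrix.smul_mul, Matrix.mul_smul]
    module
  rw [key, h, sub_self, zero_smul]

/-- Let `g : ℝ² → Mₙ(ℂ)` be twice continuously differentiable with
`g(x,y)` invertible, `a = g⁻¹ ∂ₓ g`, `b = g⁻¹ ∂ᵧ g`, and assume the harmonic map
equation `∂ₓ a + ∂ᵧ b = 0`. With `φ = (a−ib)/2`, `ψ = (a+ib)/2`, for every `ζ ≠ 0` the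
connection components `A_x = ((1−ζ)/2)φ + ((1−ζ⁻¹)/2)ψ`,
`A_y = (i(1−ζ)/2)φ − (i(1−ζ⁻¹)/2)ψ` satisfy the zero-curvature equation
`∂ₓ A_y − ∂ᵧ A_x + [A_x, A_y] = 0` identically on `ℝ²`. -/
theorem harmonic_map_zero_curvature
    (n : ℕ) (hn : 1 ≤ n)
    (g : ℝ → ℝ → Matrix (Fin n) (Fin n) ℂ)
    (hsmooth : ∀ i j, ContDiff ℝ 2 (fun p : ℝ × ℝ => g p.1 p.2 i j))
    (hinv : ∀ x y : ℝ, IsUnit (g x y))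
    (a b : ℝ → ℝ → Matrix (Fin n) (Fin n) ℂ)
    (ha : ∀ x y : ℝ, a x y = (g x y)⁻¹ *
      Matrix.of (fun i j => deriv (fun t : ℝ => g t y i j) x))
    (hb : ∀ x y : ℝ, b x y = (g x y)⁻¹ *
      Matrix.of (fun i j => deriv (fun t : ℝ => g x t i j) y))
    (hharm : ∀ x y : ℝ,
      (Matrix.of fun i j => deriv (fun t : ℝ => a t y i j) x)
        + (Matrix.of fun i j => deriv (fun t : ℝ => b x t i j) y) = 0)
    (φ ψ : ℝ → ℝ → Matrix (Fin n) (Fin n) ℂ)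
    (hφ : ∀ x y : ℝ, φ x y = ((2 : ℂ))⁻¹ • (a x y - Complex.I • b x y))
    (hψ : ∀ x y : ℝ, ψ x y = ((2 : ℂ))⁻¹ • (a x y + Complex.I • b x y)) :
    ∀ ζ : ℂ, ζ ≠ 0 →
    ∀ Ax Ay : ℝ → ℝ → Matrix (Fin n) (Fin n) ℂ,
      (∀ x y : ℝ, Ax x y = ((1 - ζ) / 2) • φ x y + ((1 - ζ⁻¹) / 2) • ψ x y) →
      (∀ x y : ℝ, Ay x y = ((Complex.I * (1 - ζ)) / 2) • φ x y
        - ((Complex.I * (1 - ζ⁻¹)) / 2) • ψ x y) →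
      ∀ x y : ℝ,
        (Matrix.of fun i j => deriv (fun t : ℝ => Ay t y i j) x)
          - (Matrix.of fun i j => deriv (fun t : ℝ => Ax x t i j) y)
          + Ax x y * Ay x y - Ay x y * Ax x y = 0 := by
  intro ζ hζ Ax Ay hAx hAy x y
  have hg : ∀ i j, Differentiable ℝ (fun p : ℝ × ℝ => g p.1 p.2 i j) := fun i j =>
    (hsmooth i j).differentiable (by norm_num)
  have hgx : ∀ i j, Differentiable ℝ (fun p : ℝ × ℝ =>
      (Matrix.of (fun i j => deriv (fun t : ℝ => g t p.2 i j) p.1)) i j) := fun i j => by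
    have := hm_diff_app (hsmooth i j) (1, 0)
    convert this using 2 with p
    exact (hm_fderiv_x (hg i j) p.1 p.2)
  have hgy : ∀ i j, Differentiable ℝ (fun p : ℝ × ℝ =>
      (Matrix.of (fun i j => deriv (fun t : ℝ => g p.1 t i j) p.2)) i j) := fun i j => by
    have := hm_diff_app (hsmooth i j) (0, 1)
    convert this using 2 with p
    exact (hm_fderiv_y (hg i j) p.1 p.2)
  have hgi := hm_inv (M := fun p : ℝ × ℝ => g p.1 p.2) hg (fun p => hinv p.1 p.2)
  have hda : ∀ i j, Differentiable ℝ (fun p : ℝ × ℝ => a p.1 p.2 i j) := by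
    simp only [ha]; exact hm_mul hgi hgx
  have hdb : ∀ i j, Differentiable ℝ (fun p : ℝ × ℝ => b p.1 p.2 i j) := by
    simp only [hb]; exact hm_mul hgi hgy
  have slx : ∀ {F : ℝ × ℝ → ℂ}, Differentiable ℝ F → ∀ y, Differentiable ℝ (fun t => F (t, y)) :=
    fun h y => h.comp (by fun_prop)
  have sly : ∀ {F : ℝ × ℝ → ℂ}, Differentiable ℝ F → ∀ x, Differentiable ℝ (fun t => F (x, t)) :=
    fun h x => h.comp (by fun_prop)
  have hdu : ∀ x y, IsUnit (g x y).det := fun x y =>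
    (Matrix.isUnit_iff_isUnit_det _).1 (hinv x y)
  have ega : ∀ x y, g x y * a x y = Matrix.of (fun i j => deriv (fun t : ℝ => g t y i j) x) :=
    fun x y => by rw [ha, Matrix.mul_nonsing_inv_cancel_left _ _ (hdu x y)]
  have egb : ∀ x y, g x y * b x y = Matrix.of (fun i j => deriv (fun t : ℝ => g x t i j) y) :=
    fun x y => by rw [hb, Matrix.mul_nonsing_inv_cancel_left _ _ (hdu x y)]
  have L1 := hm_leibniz (M := fun t => g x t) (N := fun t => a x t)
    (fun i j => sly (hg i j) x) (fun i j => sly (hda i j) x) y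
  have L2 := hm_leibniz (M := fun t => g t y) (N := fun t => b t y)
    (fun i j => slx (hg i j) y) (fun i j => slx (hdb i j) y) x
  simp only [ega, egb, Matrix.of_apply] at L1 L2
  have sym : (Matrix.of fun i j => deriv (fun t : ℝ => deriv (fun s : ℝ => g s t i j) x) y)
      = Matrix.of fun i j => deriv (fun s : ℝ => deriv (fun t : ℝ => g s t i j) y) x := by
    ext i j
    exact hm_symm (hsmooth i j) x y
  rw [sym, L2, ← ega, ← egb] at L1
  have MC : (Matrix.of fun i j => deriv (fun t : ℝ => a x t i j) y)
      - (Matrix.of fun i j => deriv (fun t : ℝ => b t y i j) x)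
      = a x y * b x y - b x y * a x y := by
    refine (hinv x y).mul_left_cancel ?_
    rw [mul_sub, mul_sub, ← mul_assoc, ← mul_assoc, sub_eq_sub_iff_add_eq_add, L1, add_comm]
  have eAx : ∀ x y, Ax x y = (((1 - ζ) / 2 + (1 - ζ⁻¹) / 2) / 2) • a x y
      + (Complex.I * ((1 - ζ⁻¹) / 2 - (1 - ζ) / 2) / 2) • b x y := fun x y => by
    rw [hAx, hφ, hψ]; module
  have eAy : ∀ x y, Ay x y = (-(Complex.I * ((1 - ζ⁻¹) / 2 - (1 - ζ) / 2) / 2)) • a x y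
      + (((1 - ζ) / 2 + (1 - ζ⁻¹) / 2) / 2) • b x y := fun x y => by
    rw [hAy, hφ, hψ]
    ext i j
    simp only [Matrix.add_apply, Matrix.sub_apply, Matrix.smul_apply, smul_eq_mul]
    linear_combination (-((1 - ζ) / 2 + (1 - ζ⁻¹) / 2) / 2 * b x y i j) * Complex.I_mul_I
  simp only [eAx, eAy]
  rw [hm_lin (M := fun t => a t y) (N := fun t => b t y)
      (fun i j => slx (hda i j) y) (fun i j => slx (hdb i j) y),
    hm_lin (M := fun t => a x t) (N := fun t => b x t)
      (fun i j => sly (hda i j) x) (fun i j => sly (hdb i j) x)]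
  refine hm_alg _ _ _ _ _ _ _ _ ?_ (hharm x y) MC
  have hz : ζ * ζ⁻¹ = 1 := mul_inv_cancel₀ hζ
  linear_combination (((1 - ζ⁻¹) / 2 - (1 - ζ) / 2) ^ 2 / 4) * Complex.I_mul_I + hz / 4
end
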